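/- arXiv:2201.11925 — 6 statements merged into one kernel-verified Lean document; each statement's English description precedes it below -/
import Mathlib

section
/- Let n ≥ 1 and let X be a metric space. Let v : X and p : ZMod n → X be points, and for each i : ZMod n write s i = dist v (p i) (the i-th spoke length) and r i = dist (p i) (p (i+1)) (the i-th rim length), so that T i denotes the triangle with vertices v, p i, p (i+1), whose side lengths are s i, s (i+1), r i. Assume general position: for every i : ZMod n, the three real numbers s i, s (i+1), r i are pairwise distinct. Then there exists an index i : ZMod n such that the spoke from v to p i is the longest side of neither adjacent triangle; precisely, there exists i with (s i < s (i+1) ∨ s i < r i) and (s i < s (i-1) ∨ s i < r (i-1)). -/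
/-- Metric-space core of Theorem 1 (no isolated interior points): in a cyclic fan of
triangles around `v`, some spoke is the longest side of neither adjacent triangle. -/
theorem exists_spoke_not_longest {n : ℕ} (hn : 1 ≤ n) {X : Type*} [MetricSpace X]
    (v : X) (p : ZMod n → X) (s r : ZMod n → ℝ)
    (hs : ∀ i, s i = dist v (p i)) (hr : ∀ i, r i = dist (p i) (p (i + 1)))
    (hgen : ∀ i : ZMod n, s i ≠ s (i + 1) ∧ s i ≠ r i ∧ s (i + 1) ≠ r i) :
    ∃ i : ZMod n, (s i < s (i + 1) ∨ s i < r i) ∧ (s i < s (i - 1) ∨ s i < r (i - 1)) := by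
  haveI : NeZero n := ⟨by omega⟩
  obtain ⟨i, hi⟩ := Finite.exists_min s
  refine ⟨i, Or.inl (lt_of_le_of_ne (hi _) (hgen i).1), Or.inl (lt_of_le_of_ne (hi _) ?_)⟩
  have h := (hgen (i - 1)).1
  rw [sub_add_cancel] at h
  exact h.symm
end

section
/- Let n ≥ 1 and let g : ZMod n → ZMod n be an injective function such that for every i : ZMod n, g i = i or g i = i + 1. Then either g i = i for all i : ZMod n, or g i = i + 1 for all i : ZMod n. -/
/-- Matching argument: an injective `g : ZMod n → ZMod n` with `g i ∈ {i, i + 1}` is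
either the identity or the rotation `i ↦ i + 1`. -/
theorem injective_zmod_id_or_succ {n : ℕ} (hn : 1 ≤ n) (g : ZMod n → ZMod n)
    (hinj : Function.Injective g) (hg : ∀ i : ZMod n, g i = i ∨ g i = i + 1) :
    (∀ i : ZMod n, g i = i) ∨ (∀ i : ZMod n, g i = i + 1) := by
  haveI : NeZero n := ⟨by omega⟩
  by_cases h : ∀ i : ZMod n, g i = i
  · exact Or.inl h
  · right
    push Not at h
    obtain ⟨j, hj⟩ := h
    have hj1 : g j = j + 1 := (hg j).resolve_left hj
    have key : ∀ k : ℕ, g (j + k) = j + k + 1 := by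
      intro k
      induction k with
      | zero => simpa using hj1
      | succ k ih =>
        have e : j + ((k + 1 : ℕ) : ZMod n) = j + k + 1 := by push_cast; ring
        rw [e]
        rcases hg (j + k + 1) with h | h
        · have h2 : j + (k : ZMod n) = j + k + 1 := hinj (ih.trans h.symm)
          rw [← h2, ih]
        · exact h
    intro i
    have := key (i - j).val
    rw [ZMod.natCast_zmod_val] at this
    simpa using this
end

section
/- Let α be a finite type, f : α → α, and ℓ : α → ℝ, and assume that for every t : α, either f (f t) = t or ℓ t < ℓ (f t). Then for every t : α there exists k : ℕ such that f (f^[k+1] t) = f^[k] t, where f^[k] denotes the k-fold iterate of f. -/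
/-- Termination of the Lepp: in a finite set of triangles, following longest-edge
neighbors always reaches a terminal pair. -/
theorem lepp_reaches_terminal {α : Type*} [Finite α] (f : α → α) (ℓ : α → ℝ)
    (h : ∀ t : α, f (f t) = t ∨ ℓ t < ℓ (f t)) :
    ∀ t : α, ∃ k : ℕ, f (f^[k + 1] t) = f^[k] t := by
  intro t
  by_contra hc
  push Not at hc
  have hm : StrictMono (fun k : ℕ => ℓ (f^[k] t)) := by
    apply strictMono_nat_of_lt_succ
    intro k
    have hk := hc k
    rw [Function.iterate_succ_apply'] at hk
    have h2 := (h (f^[k] t)).resolve_left hk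
    rw [← Function.iterate_succ_apply' f k t] at h2
    exact h2
  have hi : Function.Injective (fun k : ℕ => f^[k] t) := by
    intro a b hab
    exact hm.injective (congrArg ℓ hab)
  exact not_injective_infinite_finite _ hi
end

section
/- Let α be a finite type, f : α → α, and ℓ : α → ℝ. Assume: (i) f t ≠ t for every t : α; (ii) ℓ t ≤ ℓ (f t) for every t : α; (iii) for every t : α, either f (f t) = t or ℓ t < ℓ (f t). Fix t : α and k : ℕ with f (f^[k+1] t) = f^[k] t and with f (f^[j+1] t) ≠ f^[j] t for every j < k. Then the k + 2 elements t, f t, f^[2] t, …, f^[k+1] t are pairwise distinct. -/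
/-- The Lepp is an ordered list of distinct triangles ending at a terminal pair. -/
theorem lepp_pairwise_distinct {α : Type*} [Finite α] (f : α → α) (ℓ : α → ℝ)
    (h1 : ∀ t : α, f t ≠ t) (h2 : ∀ t : α, ℓ t ≤ ℓ (f t))
    (h3 : ∀ t : α, f (f t) = t ∨ ℓ t < ℓ (f t))
    (t : α) (k : ℕ) (hterm : f (f^[k + 1] t) = f^[k] t)
    (hk : ∀ j < k, f (f^[j + 1] t) ≠ f^[j] t) :
    ∀ i j : ℕ, i < j → j ≤ k + 1 → f^[i] t ≠ f^[j] t := by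
  intro i j hij hj he
  have hs : ∀ n, f^[n + 1] t = f (f^[n] t) := fun n => Function.iterate_succ_apply' f n t
  have hmono : Monotone (fun n => ℓ (f^[n] t)) := by
    apply monotone_nat_of_le_succ
    intro n
    simp only [hs]
    exact h2 _
  by_cases hik : i < k
  · have h := hk i hik
    rw [hs] at h
    have hlt := (h3 (f^[i] t)).resolve_left h
    have hle : ℓ (f^[i + 1] t) ≤ ℓ (f^[j] t) := hmono hij
    rw [hs, ← he] at hle
    exact absurd hlt (not_lt.mpr hle)
  · have hj' : j = i + 1 := by omega
    subst hj'
    rw [hs] at he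
    exact h1 _ he.symm
end

section
/- Let V be a real inner product space, let x y : V be nonzero vectors, let a b : ℝ with a > 0 and b > 0, and set z = a • x + b • y. If z ≠ 0, then the (undirected) angle between x and z plus the angle between z and y equals the angle between x and y: angle x z + angle z y = angle x y. -/
open InnerProductGeometry

/-- Angle additivity for a vector in the open convex cone spanned by two vectors. -/
theorem angle_add_angle_of_mem_cone {V : Type*} [NormedAddCommGroup V]
    [InnerProductSpace ℝ V] {x y : V} (hx : x ≠ 0) (hy : y ≠ 0)
    {a b : ℝ} (ha : 0 < a) (hb : 0 < b) {z : V} (hz : z = a • x + b • y) (hz0 : z ≠ 0) :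
    angle x z + angle z y = angle x y := by
  have h := angle_eq_angle_add_add_angle_add (a • x) (y := b • y) (smul_ne_zero hb.ne' hy)
  rw [← hz] at h
  rw [angle_smul_left_of_pos _ _ ha, angle_smul_right_of_pos _ _ hb,
    angle_smul_left_of_pos _ _ ha, angle_smul_left_of_pos _ _ hb] at h
  rw [h, angle_comm z y]
end

section
/- Let V be a real inner product space, let x y : V be nonzero vectors, let a b : ℝ with a ≥ 0 and b ≥ 0, and set z = a • x + b • y. If z ≠ 0, then the (undirected) angle between x and z is at most the angle between x and y: angle x z ≤ angle x y. -/
open InnerProductGeometry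

/-- Monotonicity of the undirected angle under restriction to a vector in the convex
cone spanned by two vectors. -/
theorem angle_le_of_mem_cone {V : Type*} [NormedAddCommGroup V]
    [InnerProductSpace ℝ V] {x y : V} (hx : x ≠ 0) (hy : y ≠ 0)
    {a b : ℝ} (ha : 0 ≤ a) (hb : 0 ≤ b) {z : V} (hz : z = a • x + b • y) (hz0 : z ≠ 0) :
    angle x z ≤ angle x y := by
  subst hz
  rcases hb.eq_or_lt with rfl | hb
  · rcases ha.eq_or_lt with rfl | ha
    · simp at hz0
    · rw [zero_smul, add_zero, angle_smul_right_of_pos _ _ ha, angle_self hx]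
      exact angle_nonneg _ _
  · rcases ha.eq_or_lt with rfl | ha
    · rw [zero_smul, zero_add, angle_smul_right_of_pos _ _ hb]
    · have h := angle_eq_angle_add_add_angle_add (a • x) (smul_ne_zero hb.ne' hy)
      rw [angle_smul_left_of_pos _ _ ha, angle_smul_right_of_pos _ _ hb,
        angle_smul_left_of_pos _ _ ha] at h
      linarith [angle_nonneg (b • y) (a • x + b • y)]
end
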